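/- arXiv:2002.10356 — 4 statements merged into one kernel-verified Lean document; each statement's English description precedes it below -/
import Mathlib

section
/- Let N ≥ 1 and let S : ℝ^{2N} → ℝ^{2N} be a symplectomorphism with S f_j = f_j for all j ∈ {1,…,N}. Then S is a composition of finitely many linear maps of the following two types: (i) for some j ≠ k in {1,…,N} and a ∈ ℝ, the map sending e_j ↦ e_j + a f_k and e_k ↦ e_k + a f_j and fixing all other standard basis vectors; (ii) for some j ∈ {1,…,N} and a ∈ ℝ, the map sending e_j ↦ e_j + a f_j and fixing all other standard basis vectors. -/
open scoped BigOperators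

/-- The standard symplectic form on `ℝ^{2N}`. -/
noncomputable def sympForm {N : ℕ} (V W : Fin (2 * N) → ℝ) : ℝ :=
  ∑ j : Fin N,
    (V ⟨2 * j.1, by have := j.isLt; omega⟩ * W ⟨2 * j.1 + 1, by have := j.isLt; omega⟩
      - V ⟨2 * j.1 + 1, by have := j.isLt; omega⟩ * W ⟨2 * j.1, by have := j.isLt; omega⟩)

/-- The standard basis vector `e_j`, with a `1` in coordinate `2j−1` (1-indexed). -/
noncomputable def eVec {N : ℕ} (j : Fin N) : Fin (2 * N) → ℝ :=
  fun i => if i.1 = 2 * j.1 then 1 else 0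

/-- The standard basis vector `f_j`, with a `1` in coordinate `2j` (1-indexed). -/
noncomputable def fVec {N : ℕ} (j : Fin N) : Fin (2 * N) → ℝ :=
  fun i => if i.1 = 2 * j.1 + 1 then 1 else 0

/-- Type (i): for some `j ≠ k` and `a ∈ ℝ`, the map sends `e_j ↦ e_j + a f_k`,
`e_k ↦ e_k + a f_j` and fixes all other standard basis vectors. -/
def IsTypeI {N : ℕ} (T : Module.End ℝ (Fin (2 * N) → ℝ)) : Prop :=
  ∃ (j k : Fin N) (a : ℝ), j ≠ k ∧
    T (eVec j) = eVec j + a • fVec k ∧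
    T (eVec k) = eVec k + a • fVec j ∧
    (∀ i : Fin N, i ≠ j → i ≠ k → T (eVec i) = eVec i) ∧
    (∀ i : Fin N, T (fVec i) = fVec i)

/-- Type (ii): for some `j` and `a ∈ ℝ`, the map sends `e_j ↦ e_j + a f_j`, and fixes
all other standard basis vectors. -/
def IsTypeII {N : ℕ} (T : Module.End ℝ (Fin (2 * N) → ℝ)) : Prop :=
  ∃ (j : Fin N) (a : ℝ),
    T (eVec j) = eVec j + a • fVec j ∧
    (∀ i : Fin N, i ≠ j → T (eVec i) = eVec i) ∧
    (∀ i : Fin N, T (fVec i) = fVec i)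

noncomputable def ci {N : ℕ} (j : Fin N) : Fin (2 * N) := ⟨2 * j.1, by have := j.isLt; omega⟩
noncomputable def co {N : ℕ} (j : Fin N) : Fin (2 * N) := ⟨2 * j.1 + 1, by have := j.isLt; omega⟩

theorem e_ci {N : ℕ} (j k : Fin N) : eVec j (ci k) = if k = j then 1 else 0 := by
  simp [eVec, ci, Fin.ext_iff]
theorem e_co {N : ℕ} (j k : Fin N) : eVec j (co k) = 0 := by
  unfold eVec; apply if_neg; show ¬ (2 * k.1 + 1 = 2 * j.1); omega
theorem f_co {N : ℕ} (j k : Fin N) : fVec j (co k) = if k = j then 1 else 0 := by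
  simp [fVec, co, Fin.ext_iff]
theorem f_ci {N : ℕ} (j k : Fin N) : fVec j (ci k) = 0 := by
  unfold fVec; apply if_neg; show ¬ (2 * k.1 = 2 * j.1 + 1); omega

theorem symp_eq {N : ℕ} (V W : Fin (2 * N) → ℝ) :
    sympForm V W = ∑ j : Fin N, (V (ci j) * W (co j) - V (co j) * W (ci j)) := rfl

theorem cases_idx {N : ℕ} (i : Fin (2 * N)) : (∃ j, i = ci j) ∨ (∃ j : Fin N, i = co j) := by
  have := i.isLt
  rcases Nat.even_or_odd' i.1 with ⟨m, h | h⟩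
  · exact Or.inl ⟨⟨m, by omega⟩, Fin.ext h⟩
  · exact Or.inr ⟨⟨m, by omega⟩, Fin.ext h⟩

theorem vec_ext {N : ℕ} {V W : Fin (2 * N) → ℝ} (h1 : ∀ j, V (ci j) = W (ci j))
    (h2 : ∀ j, V (co j) = W (co j)) : V = W := by
  funext i
  rcases cases_idx i with ⟨j, rfl⟩ | ⟨j, rfl⟩
  · exact h1 j
  · exact h2 j

theorem decomp {N : ℕ} (V : Fin (2 * N) → ℝ) :
    V = ∑ j, V (ci j) • eVec j + ∑ j, V (co j) • fVec j := by
  apply vec_ext <;> intro k <;> simp [Finset.sum_apply, e_ci, e_co, f_ci, f_co]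

theorem end_ext {N : ℕ} {S T : Module.End ℝ (Fin (2 * N) → ℝ)}
    (h1 : ∀ j, S (eVec j) = T (eVec j)) (h2 : ∀ j, S (fVec j) = T (fVec j)) : S = T := by
  apply LinearMap.ext
  intro V
  rw [decomp V]
  simp only [map_add, map_sum, map_smul, h1, h2]

noncomputable def Sh {N : ℕ} (B : Fin N → Fin N → ℝ) : Module.End ℝ (Fin (2 * N) → ℝ) :=
  LinearMap.id + ∑ j, (LinearMap.proj (ci j) : (Fin (2 * N) → ℝ) →ₗ[ℝ] ℝ).smulRight
    (∑ k, B j k • fVec k)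

theorem Sh_e {N : ℕ} (B : Fin N → Fin N → ℝ) (i : Fin N) :
    Sh B (eVec i) = eVec i + ∑ k, B i k • fVec k := by
  simp [Sh, e_ci]

theorem Sh_f {N : ℕ} (B : Fin N → Fin N → ℝ) (i : Fin N) :
    Sh B (fVec i) = fVec i := by
  simp [Sh, f_ci]

theorem Sh_add {N : ℕ} (B C : Fin N → Fin N → ℝ) : Sh (B + C) = Sh B * Sh C := by
  apply end_ext <;> intro i
  · simp only [Module.End.mul_apply, Sh_e, map_add, map_sum, map_smul, Sh_f, Pi.add_apply, add_smul,
      Finset.sum_add_distrib, add_assoc]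
  · simp only [Module.End.mul_apply, Sh_f]

theorem Sh_zero {N : ℕ} : Sh (0 : Fin N → Fin N → ℝ) = 1 := by
  apply end_ext <;> intro i
  · simp [Sh_e]
  · simp [Sh_f]

noncomputable def El {N : ℕ} (j k : Fin N) (a : ℝ) : Fin N → Fin N → ℝ :=
  fun p q => (if p = j ∧ q = k then a / 2 else 0) + (if p = k ∧ q = j then a / 2 else 0)

theorem El_type {N : ℕ} (j k : Fin N) (a : ℝ) : IsTypeI (Sh (El j k a)) ∨ IsTypeII (Sh (El j k a)) := by
  by_cases h : j = k
  · subst h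
    right
    refine ⟨j, a, ?_, ?_, Sh_f _⟩
    · rw [Sh_e]
      simp [El, add_smul, Finset.sum_add_distrib]
      rw [← add_smul, add_halves]
    · intro i hi
      rw [Sh_e]
      simp [El, hi]
  · left
    have h' := Ne.symm h
    refine ⟨j, k, a / 2, h, ?_, ?_, ?_, Sh_f _⟩
    · rw [Sh_e]
      simp [El, h]
    · rw [Sh_e]
      simp [El, h']
    · intro i hi hk
      rw [Sh_e]
      simp [El, hi, hk]

theorem sum_El {N : ℕ} (B : Fin N → Fin N → ℝ) (hB : ∀ j k, B j k = B k j) :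
    B = ∑ j, ∑ k, El j k (B j k) := by
  funext p q
  simp only [Finset.sum_apply, El, Finset.sum_add_distrib, ite_and]
  simp [hB q p]

/-- A symplectomorphism of `ℝ^{2N}` fixing all `f_j` is a composition of finitely many
linear maps of types (i) and (ii).  (The composite of a list of endomorphisms is its
product in the endomorphism monoid, the empty composite being the identity.) -/
theorem stmt4 (N : ℕ) (hN : 1 ≤ N)
    (S : Module.End ℝ (Fin (2 * N) → ℝ))
    (hSsymp : ∀ V W : Fin (2 * N) → ℝ, sympForm (S V) (S W) = sympForm V W)
    (hSf : ∀ j : Fin N, S (fVec j) = fVec j) :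
    ∃ L : List (Module.End ℝ (Fin (2 * N) → ℝ)),
      (∀ T ∈ L, IsTypeI T ∨ IsTypeII T) ∧ S = L.prod := by
  have symp_f : ∀ (V : Fin (2 * N) → ℝ) (k : Fin N), sympForm V (fVec k) = V (ci k) := by
    intro V k
    simp [symp_eq, f_ci, f_co]
  have hci : ∀ j k : Fin N, S (eVec j) (ci k) = if k = j then 1 else 0 := by
    intro j k
    have h := hSsymp (eVec j) (fVec k)
    rwa [hSf, symp_f, symp_f, e_ci] at h
  have hsym : ∀ j k : Fin N, S (eVec j) (co k) = S (eVec k) (co j) := by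
    intro j k
    have h := hSsymp (eVec j) (eVec k)
    simp [symp_eq, hci, e_ci, e_co] at h
    linarith
  have hS : S = Sh (fun j k => S (eVec j) (co k)) := by
    apply end_ext <;> intro i
    · rw [Sh_e]
      apply vec_ext <;> intro k
      · simp [hci, e_ci, f_ci]
      · simp [e_co, f_co]
    · rw [Sh_f, hSf]
  have key : Sh (fun j k => S (eVec j) (co k)) ∈
      Submonoid.closure {T : Module.End ℝ (Fin (2 * N) → ℝ) | IsTypeI T ∨ IsTypeII T} := by
    rw [sum_El _ hsym]
    have hadd : ∀ B C : Fin N → Fin N → ℝ,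
        Sh B ∈ Submonoid.closure {T : Module.End ℝ (Fin (2 * N) → ℝ) | IsTypeI T ∨ IsTypeII T} →
        Sh C ∈ Submonoid.closure {T : Module.End ℝ (Fin (2 * N) → ℝ) | IsTypeI T ∨ IsTypeII T} →
        Sh (B + C) ∈
          Submonoid.closure {T : Module.End ℝ (Fin (2 * N) → ℝ) | IsTypeI T ∨ IsTypeII T} := by
      intro B C h1 h2
      rw [Sh_add]
      exact mul_mem h1 h2
    have h0 : Sh (0 : Fin N → Fin N → ℝ) ∈
        Submonoid.closure {T : Module.End ℝ (Fin (2 * N) → ℝ) | IsTypeI T ∨ IsTypeII T} := by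
      rw [Sh_zero]
      exact one_mem _
    refine Finset.sum_induction _ (fun B => Sh B ∈ Submonoid.closure _) hadd h0 fun j _ => ?_
    refine Finset.sum_induction _ (fun B => Sh B ∈ Submonoid.closure _) hadd h0 fun k _ => ?_
    exact Submonoid.subset_closure (El_type _ _ _)
  rw [← hS] at key
  obtain ⟨L, hL, hp⟩ := Submonoid.exists_list_of_mem_closure key
  exact ⟨L, hL, hp.symm⟩
end

section
/- Let (x_1, y_1, …, x_N, y_N) be a symplectic basis of ℝ^{2N} and let 1 ≤ p ≤ N. For vectors x'_1,…,x'_p ∈ ℝ^{2N}, the tuple (x'_1, y_1, …, x'_p, y_p, x_{p+1}, y_{p+1}, …, x_N, y_N) is a symplectic basis of ℝ^{2N} if and only if there exists a symmetric real p×p matrix A such that x'_i = x_i + Σ_{j=1}^{p} A_{ij} y_j for all i ∈ {1,…,p}. -/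
open scoped BigOperators

/-- A tuple `(v_1, w_1, …, v_N, w_N)` of vectors of `ℝ^{2N}` is a symplectic basis if
`ω(v_i, w_j) = δ_{ij}`, `ω(v_i, v_j) = 0` and `ω(w_i, w_j) = 0` for all `i, j`. -/
def IsSymplecticBasis {N : ℕ} (v w : Fin N → (Fin (2 * N) → ℝ)) : Prop :=
  (∀ i j : Fin N, sympForm (v i) (w j) = if i = j then 1 else 0) ∧
  (∀ i j : Fin N, sympForm (v i) (v j) = 0) ∧
  (∀ i j : Fin N, sympForm (w i) (w j) = 0)

noncomputable def sympB (N : ℕ) : LinearMap.BilinForm ℝ (Fin (2 * N) → ℝ) :=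
  LinearMap.mk₂ ℝ (fun V W => sympForm V W)
    (by intro a b c; simp only [sympForm, ← Finset.sum_add_distrib, Pi.add_apply]
        exact Finset.sum_congr rfl fun j _ => by ring)
    (by intro a b c; simp only [sympForm, Finset.mul_sum, Pi.smul_apply, smul_eq_mul]
        exact Finset.sum_congr rfl fun j _ => by ring)
    (by intro a b c; simp only [sympForm, ← Finset.sum_add_distrib, Pi.add_apply]
        exact Finset.sum_congr rfl fun j _ => by ring)
    (by intro a b c; simp only [sympForm, Finset.mul_sum, Pi.smul_apply, smul_eq_mul]
        exact Finset.sum_congr rfl fun j _ => by ring)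

lemma sympB_eq {N : ℕ} (V W : Fin (2 * N) → ℝ) : sympForm V W = sympB N V W := rfl

lemma sympB_neg {N : ℕ} (V W : Fin (2 * N) → ℝ) : sympB N V W = - sympB N W V := by
  simp only [← sympB_eq, sympForm, ← Finset.sum_neg_distrib]
  exact Finset.sum_congr rfl fun j _ => by ring

lemma symp_zero {N : ℕ} (x y : Fin N → (Fin (2 * N) → ℝ))
    (h1 : ∀ i j : Fin N, sympB N (x i) (y j) = if i = j then 1 else 0)
    (h2 : ∀ i j : Fin N, sympB N (x i) (x j) = 0)
    (h3 : ∀ i j : Fin N, sympB N (y i) (y j) = 0)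
    (u : Fin (2 * N) → ℝ) (hx : ∀ k, sympB N (x k) u = 0) (hy : ∀ k, sympB N u (y k) = 0) :
    u = 0 := by
  have h4 : ∀ i j : Fin N, sympB N (y i) (x j) = if j = i then -1 else 0 := by
    intro i j; rw [sympB_neg, h1]; split_ifs <;> simp
  have key1 : ∀ (c : Fin N ⊕ Fin N → ℝ) (k : Fin N),
      sympB N (∑ i, c i • Sum.elim x y i) (y k) = c (Sum.inl k) := by
    intro c k
    simp [Fintype.sum_sum_type, h1, h3]
  have key2 : ∀ (c : Fin N ⊕ Fin N → ℝ) (k : Fin N),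
      sympB N (x k) (∑ i, c i • Sum.elim x y i) = c (Sum.inr k) := by
    intro c k
    simp [Fintype.sum_sum_type, h1, h2]
  have li : LinearIndependent ℝ (Sum.elim x y) := by
    rw [Fintype.linearIndependent_iff]
    rintro g hg (k | k)
    · rw [← key1 g k, hg]; simp
    · rw [← key2 g k, hg]; simp
  have sp := li.span_eq_top_of_card_eq_finrank' (by simp; ring)
  have hu : u ∈ Submodule.span ℝ (Set.range (Sum.elim x y)) := by rw [sp]; trivial
  obtain ⟨c, rfl⟩ := (Submodule.mem_span_range_iff_exists_fun ℝ).1 hu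
  refine Finset.sum_eq_zero ?_
  rintro (k | k) _
  · rw [← key1 c k, hy]; simp
  · rw [← key2 c k, hx]; simp

/-- Given a symplectic basis `(x_1, y_1, …, x_N, y_N)` and `1 ≤ p ≤ N`, the tuple
`(x'_1, y_1, …, x'_p, y_p, x_{p+1}, y_{p+1}, …, x_N, y_N)` is a symplectic basis iff
there is a symmetric `p×p` real matrix `A` with `x'_i = x_i + Σ_j A_{ij} y_j`. -/
theorem stmt6 (N p : ℕ) (hp : 1 ≤ p) (hpN : p ≤ N)
    (x y : Fin N → (Fin (2 * N) → ℝ))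
    (hxy : IsSymplecticBasis x y)
    (x' : Fin p → (Fin (2 * N) → ℝ)) :
    IsSymplecticBasis (fun i : Fin N => if h : i.1 < p then x' ⟨i.1, h⟩ else x i) y ↔
      ∃ A : Matrix (Fin p) (Fin p) ℝ, A.IsSymm ∧
        ∀ i : Fin p, x' i = x (Fin.castLE hpN i) +
          ∑ j : Fin p, A i j • y (Fin.castLE hpN j) := by
  obtain ⟨h1, h2, h3⟩ := hxy
  simp only [sympB_eq] at h1 h2 h3
  have h4 : ∀ i j : Fin N, sympB N (y i) (x j) = if j = i then -1 else 0 := by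
    intro i j; rw [sympB_neg, h1]; split_ifs <;> simp
  have inj : ∀ i j : Fin p, Fin.castLE hpN i = Fin.castLE hpN j ↔ i = j := by
    intro i j; simp [Fin.ext_iff]
  have cs : ∀ k : Fin N, (∃ j : Fin p, k = Fin.castLE hpN j) ∨ ¬ k.1 < p := by
    intro k
    by_cases h : k.1 < p
    · exact Or.inl ⟨⟨k.1, h⟩, rfl⟩
    · exact Or.inr h
  have ne : ∀ (k : Fin N) (j : Fin p), ¬ k.1 < p → k ≠ Fin.castLE hpN j := by
    rintro k j h rfl
    exact h j.2
  have vlt : ∀ j : Fin p, (if h : (Fin.castLE hpN j).1 < p then x' ⟨(Fin.castLE hpN j).1, h⟩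
      else x (Fin.castLE hpN j)) = x' j := by
    intro j; simp
  unfold IsSymplecticBasis
  simp only [sympB_eq]
  constructor
  · rintro ⟨g1, g2, -⟩
    have e : ∀ i : Fin p, x' i = x (Fin.castLE hpN i) +
          ∑ j : Fin p, sympB N (x (Fin.castLE hpN j)) (x' i) • y (Fin.castLE hpN j) := by
      intro i
      rw [← sub_eq_zero]
      apply symp_zero x y h1 h2 h3
      · intro k
        rcases cs k with ⟨j, rfl⟩ | hk
        · simp [h1, h2, inj]
        · have := g2 k (Fin.castLE hpN i)
          rw [vlt, dif_neg hk] at this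
          simp [h1, h2, this, ne k _ hk]
      · intro k
        have := g1 (Fin.castLE hpN i) k
        rw [vlt] at this
        simp [h1, h3, this]
    refine ⟨fun i j => sympB N (x (Fin.castLE hpN j)) (x' i), ?_, e⟩
    ext i j
    have := g2 (Fin.castLE hpN i) (Fin.castLE hpN j)
    rw [vlt, vlt, e i] at this
    have g : ∀ k, sympB N (y (Fin.castLE hpN k)) (x' j) = if j = k then -1 else 0 := by
      intro k
      have := g1 (Fin.castLE hpN j) (Fin.castLE hpN k)
      rw [vlt] at this
      rw [sympB_neg, this]; simp only [inj]; split_ifs <;> simp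
    simp [g] at this
    change sympB N (x (Fin.castLE hpN i)) (x' j) = sympB N (x (Fin.castLE hpN j)) (x' i)
    linarith
  · rintro ⟨A, hA, e⟩
    have a1 : ∀ i k, sympB N (x' i) (y k) = if Fin.castLE hpN i = k then 1 else 0 := by
      intro i k; simp [e, h1, h3]
    have a2 : ∀ i j, sympB N (x (Fin.castLE hpN j)) (x' i) = A i j := by
      intro i j; simp [e, h1, h2, inj]
    have a3 : ∀ i k, ¬ k.1 < p → sympB N (x k) (x' i) = 0 := by
      intro i k hk; simp [e, h1, h2, ne k _ hk]
    refine ⟨?_, ?_, h3⟩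
    · intro i j
      rcases cs i with ⟨i, rfl⟩ | hi
      · rw [vlt, a1]
      · rw [dif_neg hi, h1]
    · intro i j
      rcases cs i with ⟨i, rfl⟩ | hi <;> rcases cs j with ⟨j, rfl⟩ | hj
      · rw [vlt, vlt, e i]
        have g : ∀ k, sympB N (y (Fin.castLE hpN k)) (x' j) = if j = k then -1 else 0 := by
          intro k
          rw [sympB_neg, a1]; simp only [inj]; split_ifs <;> simp
        have := hA.apply i j
        simp [g, a2, this]
      · rw [vlt, dif_neg hj, sympB_neg, a3 _ _ hj, neg_zero]
      · rw [vlt, dif_neg hi, a3 _ _ hi]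
      · rw [dif_neg hi, dif_neg hj, h2]
end

section
/- Let p, c ≥ 1 and N = p + c. Let S be a real 2N×2N matrix that is symplectic for ω, i.e. ω(S·V, S·W) = ω(V, W) for all V, W ∈ ℝ^{2N}, and suppose: for each k ∈ {1,…,p} the (2k)-th row of S equals a vector g_k ∈ ℝ^{2N}; for each k ∈ {1,…,c} the (2p+2k−1)-th row of S equals a vector μ_k ∈ ℝ^{2N} and the (2p+2k)-th row of S equals (1/2)·λ_k for a vector λ_k ∈ ℝ^{2N}. Let F be the (p+2c)×2N matrix whose rows, in order, are g_1,…,g_p, μ_1, λ_1, …, μ_c, λ_c. Fix real numbers A_1,…,A_p and A^λ_1, A^μ_1, …, A^λ_c, A^μ_c, and define v ∈ ℝ^{2N} by v_{2k−1} = A_k and v_{2k} = 0 for k ∈ {1,…,p}, v_{2p+2k−1} = A^λ_k and v_{2p+2k} = A^μ_k for k ∈ {1,…,c}; define w ∈ ℝ^{p+2c} by w_k = A_k for k ∈ {1,…,p}, w_{p+2k−1} = −A^μ_k and w_{p+2k} = (1/2)·A^λ_k for k ∈ {1,…,c}. Then every Z ∈ ℝ^{2N} with S·Z = v satisfies Z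 = −J·(Fᵀ·w), where Fᵀ is the transpose of F. -/
open scoped BigOperators

/-- The map `J : ℝ^{2N} → ℝ^{2N}` with `(J V)_{2j−1} = −V_{2j}` and `(J V)_{2j} = V_{2j−1}`
(1-indexed); it satisfies `ω(V, W) = (J V)·W`. -/
noncomputable def Jmap {N : ℕ} (V : Fin (2 * N) → ℝ) : Fin (2 * N) → ℝ :=
  fun i =>
    if h : i.1 % 2 = 0 then -V ⟨i.1 + 1, by have := i.isLt; omega⟩
    else V ⟨i.1 - 1, by have := i.isLt; omega⟩

theorem sum_two_mul_aux (c : ℕ) (f : Fin (2 * c) → ℝ) :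
    ∑ i, f i = ∑ j : Fin c, (f ⟨2 * j.1, by have := j.isLt; omega⟩
      + f ⟨2 * j.1 + 1, by have := j.isLt; omega⟩) := by
  induction c with
  | zero => simp
  | succ n ih =>
    rw [Fin.sum_univ_castSucc (n := n)]
    have h := Fin.sum_univ_castSucc (n := 2 * n + 1) f
    rw [Fin.sum_univ_castSucc (n := 2 * n)] at h
    refine h.trans ?_
    have h2 := ih (fun i => f i.castSucc.castSucc)
    rw [h2, add_assoc]
    rfl

theorem symp_single_even {N : ℕ} (Z : Fin (2 * N) → ℝ) (j : Fin N) :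
    sympForm Z (Pi.single ⟨2 * j.1, by have := j.isLt; omega⟩ 1)
      = - Z ⟨2 * j.1 + 1, by have := j.isLt; omega⟩ := by
  unfold sympForm
  rw [Finset.sum_eq_single j]
  · simp [Pi.single_apply]
  · intro b _ hb
    have h1 : ¬ (2 * b.1 + 1 = 2 * j.1) := by omega
    have h2 : ¬ (b.1 = j.1) := fun h => hb (Fin.ext h)
    simp [Pi.single_apply, h1, h2]
  · simp

theorem symp_single_odd {N : ℕ} (Z : Fin (2 * N) → ℝ) (j : Fin N) :
    sympForm Z (Pi.single ⟨2 * j.1 + 1, by have := j.isLt; omega⟩ 1)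
      = Z ⟨2 * j.1, by have := j.isLt; omega⟩ := by
  unfold sympForm
  rw [Finset.sum_eq_single j]
  · simp [Pi.single_apply]
  · intro b _ hb
    have h1 : ¬ (2 * b.1 = 2 * j.1 + 1) := by omega
    have h2 : ¬ (b.1 = j.1) := fun h => hb (Fin.ext h)
    simp [Pi.single_apply, h1, h2]
  · simp

/-- "Inverting without inverting": if `S` is a symplectic `2N×2N` matrix (`N = p + c`)
whose `2k`-th rows are `g_k` (for `k ≤ p`), and whose `(2p+2k−1)`-th and `(2p+2k)`-th rows
are `μ_k` and `(1/2)λ_k` (for `k ≤ c`), and `F` is the `(p+2c)×2N` matrix with rows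
`g_1,…,g_p, μ_1, λ_1, …, μ_c, λ_c`, then for `v` and `w` built from constants
`A_1,…,A_p, A^λ_1, A^μ_1, …, A^λ_c, A^μ_c` as described, every solution `Z` of `S·Z = v`
satisfies `Z = −J·(Fᵀ·w)`.  (All indices below are 0-indexed.) -/
theorem stmt11 (p c : ℕ) (hp : 1 ≤ p) (hc : 1 ≤ c)
    (S : Matrix (Fin (2 * (p + c))) (Fin (2 * (p + c))) ℝ)
    (hSsymp : ∀ V W : Fin (2 * (p + c)) → ℝ,
      sympForm (S.mulVec V) (S.mulVec W) = sympForm V W)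
    (g : Fin p → (Fin (2 * (p + c)) → ℝ))
    (mu lam : Fin c → (Fin (2 * (p + c)) → ℝ))
    (hSg : ∀ k : Fin p, S ⟨2 * k.1 + 1, by have := k.isLt; omega⟩ = g k)
    (hSmu : ∀ k : Fin c, S ⟨2 * p + 2 * k.1, by have := k.isLt; omega⟩ = mu k)
    (hSlam : ∀ k : Fin c,
      S ⟨2 * p + 2 * k.1 + 1, by have := k.isLt; omega⟩ = (1 / 2 : ℝ) • lam k)
    (F : Matrix (Fin (p + 2 * c)) (Fin (2 * (p + c))) ℝ)
    (hFg : ∀ i : Fin p, F ⟨i.1, by have := i.isLt; omega⟩ = g i)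
    (hFmu : ∀ k : Fin c, F ⟨p + 2 * k.1, by have := k.isLt; omega⟩ = mu k)
    (hFlam : ∀ k : Fin c, F ⟨p + 2 * k.1 + 1, by have := k.isLt; omega⟩ = lam k)
    (A : Fin p → ℝ) (Alam Amu : Fin c → ℝ)
    (v : Fin (2 * (p + c)) → ℝ)
    (hv1 : ∀ k : Fin p, v ⟨2 * k.1, by have := k.isLt; omega⟩ = A k)
    (hv2 : ∀ k : Fin p, v ⟨2 * k.1 + 1, by have := k.isLt; omega⟩ = 0)
    (hv3 : ∀ k : Fin c, v ⟨2 * p + 2 * k.1, by have := k.isLt; omega⟩ = Alam k)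
    (hv4 : ∀ k : Fin c, v ⟨2 * p + 2 * k.1 + 1, by have := k.isLt; omega⟩ = Amu k)
    (w : Fin (p + 2 * c) → ℝ)
    (hw1 : ∀ k : Fin p, w ⟨k.1, by have := k.isLt; omega⟩ = A k)
    (hw2 : ∀ k : Fin c, w ⟨p + 2 * k.1, by have := k.isLt; omega⟩ = -Amu k)
    (hw3 : ∀ k : Fin c,
      w ⟨p + 2 * k.1 + 1, by have := k.isLt; omega⟩ = (1 / 2 : ℝ) * Alam k) :
    ∀ Z : Fin (2 * (p + c)) → ℝ, S.mulVec Z = v → Z = -(Jmap (F.transpose.mulVec w)) := by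
  intro Z hZ
  have key : ∀ i, (F.transpose.mulVec w) i = sympForm Z (Pi.single i 1) := by
    intro i
    rw [← hSsymp, hZ, Matrix.mulVec_single_one]
    unfold sympForm
    simp only [Matrix.mulVec, dotProduct, Matrix.transpose_apply, Matrix.col_apply]
    rw [Fin.sum_univ_add, Fin.sum_univ_add, sum_two_mul_aux]
    congr 1
    · refine Finset.sum_congr rfl fun k _ => ?_
      have a1 := congrFun (hFg k) i
      have a2 := hw1 k
      have a3 := congrFun (hSg k) i
      have a4 := hv1 k
      have a5 := hv2 k
      simp only [Fin.val_castAdd, a3, a4, a5]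
      change F ⟨k.1, _⟩ i * w ⟨k.1, _⟩ = _
      rw [a1, a2]; ring
    · refine Finset.sum_congr rfl fun k _ => ?_
      have a1 := congrFun (hFmu k) i
      have a2 := congrFun (hFlam k) i
      have a3 := hw2 k
      have a4 := hw3 k
      have a5 := congrFun (hSmu k) i
      have a6 := congrFun (hSlam k) i
      have a7 := hv3 k
      have a8 := hv4 k
      simp only [Pi.smul_apply, smul_eq_mul] at a6
      simp only [Fin.val_natAdd, mul_add, a5, a6, a7, a8]
      change F ⟨p + 2 * k.1, _⟩ i * w ⟨p + 2 * k.1, _⟩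
        + F ⟨p + 2 * k.1 + 1, _⟩ i * w ⟨p + 2 * k.1 + 1, _⟩ = _
      rw [a1, a2, a3, a4]; ring
  funext i
  obtain ⟨i, hi⟩ := i
  rcases Nat.even_or_odd' i with ⟨j, rfl | rfl⟩
  · have hj : j < p + c := by omega
    have e := symp_single_odd Z ⟨j, hj⟩
    simp [Jmap, key, e]
  · have hj : j < p + c := by omega
    have e := symp_single_even Z ⟨j, hj⟩
    have h1 : (2 * j + 1) % 2 = 1 := by omega
    simp [Jmap, key, e, h1]
end

section
/- Let N ≥ 2, let M be an m×2N integer matrix and C ∈ ℤ^m. Suppose: (a) there are vectors r_f, r_h ∈ ℤ^{2N} whose first four entries are (0,1,0,1) and (1,0,1,0) respectively, such that every row r of M (regarded as a vector in ℤ^{2N}) satisfies ω(r_f, r) = 0 and ω(r_h, r) = 0; (b) M has a row equal to the vector with first four entries (1,0,−1,0) and all other entries 0, and a row equal to the vector with first four entries (0,1,0,−1) and all other entries 0, and the entries of C corresponding to these two rows are both 0; (c) A ∈ ℤ^{2N} satisfies M·A = C. Then the vector B = A + A_1·(J r_f) − A_2·(J r_h), where A_1 and A_2 denote the first and second entries of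 A, satisfies M·B = C and has B_1 = B_2 = B_3 = B_4 = 0. -/
open scoped BigOperators

/-- The standard symplectic pairing on `ℤ^{2N}`:
`ω(V,W) = Σ_{j=1}^{N} (V_{2j−1} W_{2j} − V_{2j} W_{2j−1})` (1-indexed). -/
def sympFormZ {N : ℕ} (V W : Fin (2 * N) → ℤ) : ℤ :=
  ∑ j : Fin N,
    (V ⟨2 * j.1, by have := j.isLt; omega⟩ * W ⟨2 * j.1 + 1, by have := j.isLt; omega⟩
      - V ⟨2 * j.1 + 1, by have := j.isLt; omega⟩ * W ⟨2 * j.1, by have := j.isLt; omega⟩)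

/-- The map `J : ℤ^{2N} → ℤ^{2N}` with `(J V)_{2j−1} = −V_{2j}` and `(J V)_{2j} = V_{2j−1}`
(1-indexed); it satisfies `ω(V, W) = (J V)·W`. -/
def JmapZ {N : ℕ} (V : Fin (2 * N) → ℤ) : Fin (2 * N) → ℤ :=
  fun i =>
    if h : i.1 % 2 = 0 then -V ⟨i.1 + 1, by have := i.isLt; omega⟩
    else V ⟨i.1 - 1, by have := i.isLt; omega⟩

theorem sum_pairs {N : ℕ} (f : Fin (2 * N) → ℤ) :
    ∑ i, f i = ∑ j : Fin N,
      (f ⟨2 * j.1, by have := j.isLt; omega⟩ + f ⟨2 * j.1 + 1, by have := j.isLt; omega⟩) := by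
  rw [← Equiv.sum_comp (finProdFinEquiv.trans (finCongr (Nat.mul_comm N 2))) f,
    Fintype.sum_prod_type]
  refine Finset.sum_congr rfl fun j _ => ?_
  rw [Fin.sum_univ_two]
  congr 2
  · ext; simp
  · ext; simp; omega

theorem J_dot {N : ℕ} (V W : Fin (2 * N) → ℤ) : W ⬝ᵥ JmapZ V = sympFormZ V W := by
  unfold dotProduct sympFormZ
  rw [sum_pairs]
  refine Finset.sum_congr rfl fun j _ => ?_
  have h : (2 * j.1 + 1) % 2 ≠ 0 := by omega
  simp [JmapZ, h]
  ring

theorem dot_two {n : ℕ} (A : Fin n → ℤ) (a b : ℕ) (ha : a < n) (hb : b < n) (hab : a ≠ b) :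
    (fun j : Fin n => if j.1 = a then (1 : ℤ) else if j.1 = b then -1 else 0) ⬝ᵥ A
      = A ⟨a, ha⟩ - A ⟨b, hb⟩ := by
  have : (fun j : Fin n => if j.1 = a then (1 : ℤ) else if j.1 = b then -1 else 0)
      = Pi.single ⟨a, ha⟩ 1 - Pi.single ⟨b, hb⟩ 1 := by
    funext j
    simp only [Pi.sub_apply, Pi.single_apply, Fin.ext_iff]
    split_ifs <;> first | omega | simp
  rw [this, sub_dotProduct]
  simp

/-- Adjusting an integer solution `A` of `M·A = C` by `A_1·(J r_f) − A_2·(J r_h)` produces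
a solution `B` whose first four entries vanish, given: every row `r` of `M` satisfies
`ω(r_f, r) = 0 = ω(r_h, r)` where `r_f`, `r_h` have first four entries `(0,1,0,1)` and
`(1,0,1,0)`; and `M` has rows with first four entries `(1,0,−1,0)` and `(0,1,0,−1)` (and
zeros elsewhere) whose corresponding entries of `C` are `0`.  (0-indexed below.) -/
theorem stmt12 (N m : ℕ) (hN : 2 ≤ N)
    (M : Matrix (Fin m) (Fin (2 * N)) ℤ) (C : Fin m → ℤ)
    (rf rh : Fin (2 * N) → ℤ)
    (hrf0 : rf ⟨0, by omega⟩ = 0) (hrf1 : rf ⟨1, by omega⟩ = 1)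
    (hrf2 : rf ⟨2, by omega⟩ = 0) (hrf3 : rf ⟨3, by omega⟩ = 1)
    (hrh0 : rh ⟨0, by omega⟩ = 1) (hrh1 : rh ⟨1, by omega⟩ = 0)
    (hrh2 : rh ⟨2, by omega⟩ = 1) (hrh3 : rh ⟨3, by omega⟩ = 0)
    (horth : ∀ i : Fin m, sympFormZ rf (M i) = 0 ∧ sympFormZ rh (M i) = 0)
    (i₁ : Fin m)
    (hrow1 : M i₁ = fun j : Fin (2 * N) =>
      if j.1 = 0 then 1 else if j.1 = 2 then -1 else 0)
    (hC1 : C i₁ = 0)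
    (i₂ : Fin m)
    (hrow2 : M i₂ = fun j : Fin (2 * N) =>
      if j.1 = 1 then 1 else if j.1 = 3 then -1 else 0)
    (hC2 : C i₂ = 0)
    (A : Fin (2 * N) → ℤ) (hA : M.mulVec A = C) :
    ∀ B : Fin (2 * N) → ℤ,
      B = A + A ⟨0, by omega⟩ • JmapZ rf - A ⟨1, by omega⟩ • JmapZ rh →
      M.mulVec B = C ∧
      B ⟨0, by omega⟩ = 0 ∧ B ⟨1, by omega⟩ = 0 ∧
      B ⟨2, by omega⟩ = 0 ∧ B ⟨3, by omega⟩ = 0 := by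
  intro B hB
  have h1 : A ⟨0, by omega⟩ - A ⟨2, by omega⟩ = 0 := by
    rw [← dot_two A 0 2 (by omega) (by omega) (by omega), ← hrow1, ← hC1, ← hA]; rfl
  have h2 : A ⟨1, by omega⟩ - A ⟨3, by omega⟩ = 0 := by
    rw [← dot_two A 1 3 (by omega) (by omega) (by omega), ← hrow2, ← hC2, ← hA]; rfl
  have hf : M.mulVec (JmapZ rf) = 0 := by
    funext i
    exact (J_dot rf (M i)).trans (horth i).1
  have hh : M.mulVec (JmapZ rh) = 0 := by
    funext i
    exact (J_dot rh (M i)).trans (horth i).2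
  subst hB
  refine ⟨?_, ?_, ?_, ?_, ?_⟩
  · rw [Matrix.mulVec_sub, Matrix.mulVec_add, Matrix.mulVec_smul, Matrix.mulVec_smul, hf, hh, hA]
    simp
  all_goals
    simp [JmapZ, hrf0, hrf1, hrf2, hrf3, hrh0, hrh1, hrh2, hrh3]
  all_goals linarith
end
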